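/- Let A be a unital locally C*-algebra whose defining monotone family of C*-seminorms (p_λ)_{λ∈Λ} is indexed by a directed poset Λ, let H = ⋃_{λ∈Λ} H_λ be a locally Hilbert space over the same Λ, and let φ : A → B_loc(H) be a coherent linear map. The following are equivalent: (1) φ is positive semidefinite (equivalently, completely positive); (2) there exist a locally Hilbert space K = ⋃_{λ∈Λ} K_λ over Λ, a coherent *-representation π : A → B_loc(K) (i.e., π is linear, π(ab) = π(a) ∘ π(b), π(a*) = π(a)*, and p_λ(a) = 0 implies π(a)k = 0 for all k ∈ K_λ), and W ∈ B_loc(H,K) such that φ(a) = W* ∘ π(a) ∘ W for all a ∈ A. -/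

import Mathlib

open scoped InnerProductSpace ComplexOrder

noncomputable section

universe u v w

/-- A locally Hilbert space structure over the directed poset `Λ` on the
inner product space `H`: a monotone family of complete subspaces whose union is `H`. -/
structure LocallyHilbert (Λ : Type v) [PartialOrder Λ] (H : Type u)
    [NormedAddCommGroup H] [InnerProductSpace ℂ H] : Type (max u v) where
  E : Λ → Submodule ℂ H
  mono : Monotone E
  isComplete : ∀ lam : Λ, IsComplete (E lam : Set H)
  exhaustive : ∀ h : H, ∃ lam : Λ, h ∈ E lam

/-- A bundled locally Hilbert space over `Λ`. -/
structure LocHilbertBundle (Λ : Type v) [PartialOrder Λ] : Type (max (u + 1) v) where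
  carrier : Type u
  [ngroup : NormedAddCommGroup carrier]
  [ips : InnerProductSpace ℂ carrier]
  str : LocallyHilbert Λ carrier

attribute [instance] LocHilbertBundle.ngroup LocHilbertBundle.ips

variable {Λ : Type v} [PartialOrder Λ]
variable {H : Type u} [NormedAddCommGroup H] [InnerProductSpace ℂ H]
variable {K : Type w} [NormedAddCommGroup K] [InnerProductSpace ℂ K]

/-- `T : H → K` is a locally bounded operator: it maps each `H_λ` into `K_λ`, boundedly,
and (equivalently to the usual formulation) the adjoints of its restrictions are
compatible, i.e. for every `k ∈ K_λ` the functional `h ↦ ⟪T h, k⟫` is represented by a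
vector of `H_λ`. -/
structure IsLocallyBounded (hH : LocallyHilbert Λ H) (hK : LocallyHilbert Λ K)
    (T : H →ₗ[ℂ] K) : Prop where
  maps_mem : ∀ lam : Λ, ∀ h ∈ hH.E lam, T h ∈ hK.E lam
  bound : ∀ lam : Λ, ∃ C : ℝ, ∀ h ∈ hH.E lam, ‖T h‖ ≤ C * ‖h‖
  adjoint_mem : ∀ lam : Λ, ∀ k ∈ hK.E lam, ∃ v ∈ hH.E lam,
    ∀ h : H, ⟪T h, k⟫_ℂ = ⟪h, v⟫_ℂ

/-- `S` is the (formal) adjoint of `T`. -/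
def IsLAdjoint (T : H →ₗ[ℂ] K) (S : K →ₗ[ℂ] H) : Prop :=
  ∀ (h : H) (k : K), ⟪T h, k⟫_ℂ = ⟪h, S k⟫_ℂ

/-- The operator norm of the restriction of `T` to the submodule `p`. -/
def restNorm (p : Submodule ℂ H) (T : H →ₗ[ℂ] K) : ℝ :=
  sInf {C : ℝ | 0 ≤ C ∧ ∀ h ∈ p, ‖T h‖ ≤ C * ‖h‖}

/-- Positive semidefiniteness of a kernel with values locally bounded operators. -/
def IsPSDKernel {X : Type*} (k : X → X → (H →ₗ[ℂ] H)) : Prop :=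
  ∀ (n : ℕ) (x : Fin n → X) (h : Fin n → H),
    0 ≤ ∑ i, ∑ j, ⟪h i, k (x i) (x j) (h j)⟫_ℂ


universe x

/-- A locally C*-algebra structure on the complex associative `*`-algebra `A`: a
monotone family of C*-seminorms indexed by a directed poset `I`, which separates the
points of `A` (Hausdorff) and for which `A` is complete; completeness is expressed via
Cauchy filters for the family of seminorms. -/
structure LocallyCStar (I : Type x) [Preorder I] (A : Type w)
    [Ring A] [StarRing A] [Algebra ℂ A] [StarModule ℂ A] : Type (max w x) where
  p : I → A → ℝ
  nonneg : ∀ (i : I) (a : A), 0 ≤ p i a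
  add_le : ∀ (i : I) (a b : A), p i (a + b) ≤ p i a + p i b
  smul_eq : ∀ (i : I) (c : ℂ) (a : A), p i (c • a) = ‖c‖ * p i a
  mul_le : ∀ (i : I) (a b : A), p i (a * b) ≤ p i a * p i b
  star_eq : ∀ (i : I) (a : A), p i (star a) = p i a
  cstar : ∀ (i : I) (a : A), p i (star a * a) = p i a ^ 2
  mono : ∀ ⦃i j : I⦄, i ≤ j → ∀ a : A, p i a ≤ p j a
  separating : ∀ a : A, (∀ i : I, p i a = 0) → a = 0
  complete : ∀ F : Filter A, F.NeBot →
    (∀ (i : I) (ε : ℝ), 0 < ε → ∃ s ∈ F, ∀ a ∈ s, ∀ b ∈ s, p i (a - b) < ε) →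
    ∃ x : A, ∀ (i : I) (ε : ℝ), 0 < ε → {a : A | p i (a - x) < ε} ∈ F

section PolynomialCalculus

open Polynomial Filter Topology ENNReal

/-- In a complex Banach algebra, a bound for a polynomial on the spectrum of `x` bounds its value at
`x` in norm, provided that norm equals the spectral radius. -/
theorem norm_aeval_le_of_spectrum_subset {B : Type*} [NormedRing B] [NormedAlgebra ℂ B]
    [CompleteSpace B] (x : B) (q : ℂ[X])
    (hsq : ∀ n : ℕ, ‖aeval x q ^ 2 ^ n‖ = ‖aeval x q‖ ^ 2 ^ n) {M : ℝ} (hM : 0 ≤ M)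
    (hq : ∀ z ∈ spectrum ℂ x, ‖q.eval z‖ ≤ M) : ‖aeval x q‖ ≤ M := by
  rcases subsingleton_or_nontrivial B with _ | _
  · simpa [Subsingleton.elim (aeval x q) 0] using hM
  have h1 : spectralRadius ℂ (aeval x q) ≤ ENNReal.ofReal M := by
    refine iSup₂_le fun k hk => ?_
    rw [spectrum.map_polynomial_aeval] at hk
    obtain ⟨z, hz, rfl⟩ := hk
    rw [← enorm_eq_nnnorm, ← ofReal_norm]
    exact ENNReal.ofReal_le_ofReal (hq z hz)
  have h2 := (spectrum.pow_norm_pow_one_div_tendsto_nhds_spectralRadius (aeval x q)).comp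
    (tendsto_pow_atTop_atTop_of_one_lt (one_lt_two : (1 : ℕ) < 2))
  have h3 : ∀ n : ℕ, ENNReal.ofReal (‖aeval x q ^ 2 ^ n‖ ^ (1 / ((2 ^ n : ℕ) : ℝ)))
      = ENNReal.ofReal ‖aeval x q‖ := fun n => by
    rw [hsq, one_div, Real.pow_rpow_inv_natCast (norm_nonneg _) (by positivity)]
  have h4 := tendsto_nhds_unique (h2.congr h3) tendsto_const_nhds
  rw [h4] at h1
  exact (ENNReal.ofReal_le_ofReal_iff hM).1 h1

/-- Arens' argument: the norm growth of `x + i s` forces the spectrum of `x` to be real. -/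
theorem im_eq_zero_of_mem_spectrum {B : Type*} [NormedRing B] [NormedAlgebra ℂ B]
    [CompleteSpace B] (x : B) (h1 : ‖(1 : B)‖ ≤ 1)
    (him : ∀ s : ℝ, ‖x + algebraMap ℂ B (s * Complex.I)‖ ^ 2 ≤ ‖x‖ ^ 2 + s ^ 2) {z : ℂ}
    (hz : z ∈ spectrum ℂ x) : z.im = 0 := by
  have key : ∀ s : ℝ, z.re ^ 2 + (z.im + s) ^ 2 ≤ ‖x‖ ^ 2 + s ^ 2 := fun s => by
    have hm : z + s * Complex.I ∈ spectrum ℂ (x + algebraMap ℂ B (s * Complex.I)) := by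
      rw [add_comm x]
      exact spectrum.add_mem_add_iff.2 hz
    have h := spectrum.norm_le_norm_mul_of_mem hm
    have h' : ‖z + s * Complex.I‖ ≤ ‖x + algebraMap ℂ B (s * Complex.I)‖ :=
      h.trans (mul_le_of_le_one_right (norm_nonneg _) h1)
    have h'' := (pow_le_pow_left₀ (norm_nonneg _) h' 2).trans (him s)
    rw [← Complex.normSq_eq_norm_sq, Complex.normSq_apply] at h''
    simp at h''
    nlinarith
  by_contra hne
  have := key ((‖x‖ ^ 2 + 1) / (2 * z.im))
  have h3 : 2 * z.im * ((‖x‖ ^ 2 + 1) / (2 * z.im)) = ‖x‖ ^ 2 + 1 := by field_simp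
  nlinarith [sq_nonneg z.re, sq_nonneg z.im]

theorem norm_aeval_le_of_real {R : Type*} [SeminormedCommRing R] [NormedAlgebra ℂ R] (x : R)
    (h1 : ‖(1 : R)‖ ≤ 1)
    (him : ∀ s : ℝ, ‖x + algebraMap ℂ R (s * Complex.I)‖ ^ 2 ≤ ‖x‖ ^ 2 + s ^ 2) (q : ℂ[X])
    (hsq : ∀ n : ℕ, ‖aeval x q ^ 2 ^ n‖ = ‖aeval x q‖ ^ 2 ^ n) {M : ℝ} (hM : 0 ≤ M)
    (hq : ∀ t : ℝ, |t| ≤ ‖x‖ → ‖q.eval (t : ℂ)‖ ≤ M) : ‖aeval x q‖ ≤ M := by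
  let ι : R →ₐ[ℂ] UniformSpace.Completion R :=
    { UniformSpace.Completion.coeRingHom with
      commutes' := fun r => rfl }
  have hι : ∀ y : R, ‖ι y‖ = ‖y‖ := UniformSpace.Completion.norm_coe
  have hιa : aeval (ι x) q = ι (aeval x q) := aeval_algHom_apply ι x q
  have h1' : ‖(1 : UniformSpace.Completion R)‖ ≤ 1 := by rwa [← map_one ι, hι]
  rw [← hι, ← hιa]
  refine norm_aeval_le_of_spectrum_subset _ _ (fun n => ?_) hM fun z hz => ?_
  · rw [hιa, ← map_pow, hι, hι, hsq]
  · have hz0 := im_eq_zero_of_mem_spectrum (ι x) h1' (fun s => by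
      rw [← ι.commutes, ← map_add, hι, hι]; exact him s) hz
    have hzr : z = (z.re : ℂ) := by apply Complex.ext <;> simp [hz0]
    rw [hzr]
    apply hq
    refine (Complex.abs_re_le_norm z).trans ((spectrum.norm_le_norm_mul_of_mem hz).trans ?_)
    rw [hι]
    exact mul_le_of_le_one_right (norm_nonneg _) h1'

end PolynomialCalculus

namespace LocallyCStar

open Polynomial Filter Topology

/-- Evaluation of a real polynomial at an element of a complex algebra. -/
def realEval {A : Type*} [Ring A] [Algebra ℂ A] (y : A) : ℝ[X] →+* A :=
  (aeval y : ℂ[X] →ₐ[ℂ] A).toRingHom.comp (mapRingHom (algebraMap ℝ ℂ))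

theorem realEval_X {A : Type*} [Ring A] [Algebra ℂ A] (y : A) : realEval y X = y := by
  simp [realEval]

variable {I : Type x} [Preorder I] {A : Type w} [Ring A] [StarRing A] [Algebra ℂ A]
  [StarModule ℂ A] (pA : LocallyCStar I A) (i : I)

theorem p_zero : pA.p i 0 = 0 := by
  simpa using pA.smul_eq i 0 0

theorem p_neg (a : A) : pA.p i (-a) = pA.p i a := by
  simpa using pA.smul_eq i (-1) a

theorem p_one_le : pA.p i 1 ≤ 1 := by
  have h := pA.cstar i 1
  simp only [star_one, mul_one] at h
  nlinarith [pA.nonneg i 1]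

theorem p_pow_two_pow {z : A} (hz : star z = z) (n : ℕ) :
    pA.p i (z ^ 2 ^ n) = pA.p i z ^ 2 ^ n := by
  induction n with
  | zero => simp
  | succ n ih =>
    have h := pA.cstar i (z ^ 2 ^ n)
    rw [star_pow, hz, ← pow_two, ← pow_mul, ih, ← pow_mul, ← pow_succ] at h
    exact h

theorem p_add_imaginary_sq_le {y : A} (hy : star y = y) (s : ℝ) :
    pA.p i (y + algebraMap ℂ A (s * Complex.I)) ^ 2 ≤ pA.p i y ^ 2 + s ^ 2 := by
  have h : star (y + algebraMap ℂ A (s * Complex.I)) * (y + algebraMap ℂ A (s * Complex.I))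
      = star y * y + ((s ^ 2 : ℝ) : ℂ) • (1 : A) := by
    have h2 : star (algebraMap ℂ A (s * Complex.I)) = - algebraMap ℂ A (s * Complex.I) := by
      rw [← algebraMap_star_comm, ← map_neg]
      simp
    have h3 : algebraMap ℂ A (s * Complex.I) * algebraMap ℂ A (s * Complex.I)
        = - algebraMap ℂ A ((s ^ 2 : ℝ) : ℂ) := by
      rw [← map_mul, ← map_neg]
      congr 1
      push_cast
      linear_combination (s : ℂ) ^ 2 * Complex.I_mul_I
    rw [star_add, h2, hy, ← Algebra.algebraMap_eq_smul_one, add_mul, mul_add, mul_add, neg_mul,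
      neg_mul, h3, Algebra.commutes (s * Complex.I : ℂ) y]
    abel
  rw [← pA.cstar, h]
  refine (pA.add_le _ _ _).trans ?_
  rw [pA.cstar, pA.smul_eq]
  have : ‖((s ^ 2 : ℝ) : ℂ)‖ = s ^ 2 := by
    rw [Complex.norm_real, Real.norm_of_nonneg (sq_nonneg s)]
  rw [this]
  nlinarith [mul_le_mul_of_nonneg_left (pA.p_one_le i) (sq_nonneg s)]

theorem star_realEval {y : A} (hy : star y = y) (q : ℝ[X]) :
    star (realEval y q) = realEval y q := by
  induction q using Polynomial.induction_on' with
  | add p q hp hq => rw [map_add, star_add, hp, hq]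
  | monomial n c =>
    simp [realEval, aeval_monomial, hy, ← algebraMap_star_comm, Algebra.commutes]

/-- The C*-seminorm of `q(y)`, `y` selfadjoint, is bounded by the supremum of `|q|` on
`[-p(y), p(y)]`. -/
theorem p_realEval_le {y : A} (hy : star y = y) (q : ℝ[X]) {M : ℝ} (hM : 0 ≤ M)
    (hq : ∀ t : ℝ, |t| ≤ pA.p i y → |q.eval t| ≤ M) : pA.p i (realEval y q) ≤ M := by
  let N : RingSeminorm ℂ[X] :=
    { toFun := fun r => pA.p i (aeval y r)
      map_zero' := by simp [pA.p_zero]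
      add_le' := fun r s => by rw [map_add]; exact pA.add_le _ _ _
      neg' := fun r => by rw [map_neg, pA.p_neg]
      mul_le' := fun r s => by rw [map_mul]; exact pA.mul_le _ _ _ }
  let _ : SeminormedCommRing ℂ[X] := { N.toSeminormedRing with mul_comm := mul_comm }
  have hN : ∀ r : ℂ[X], ‖r‖ = pA.p i (aeval y r) := fun r => rfl
  let _ : NormedAlgebra ℂ ℂ[X] :=
    { (inferInstance : Algebra ℂ ℂ[X]) with
      norm_smul_le := fun c r => by rw [hN, hN, map_smul, pA.smul_eq] }
  have hX : ‖(X : ℂ[X])‖ = pA.p i y := by rw [hN, aeval_X]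
  have haeval : aeval (X : ℂ[X]) (q.map (algebraMap ℝ ℂ)) = q.map (algebraMap ℝ ℂ) :=
    aeval_X_left_apply _
  have := norm_aeval_le_of_real (X : ℂ[X]) (by rw [hN, map_one]; exact pA.p_one_le i)
    (fun s => by
      rw [hX, hN, map_add, aeval_X, AlgHom.commutes]
      exact pA.p_add_imaginary_sq_le i hy s)
    (q.map (algebraMap ℝ ℂ))
    (fun n => by
      rw [haeval, hN, hN, map_pow]
      exact pA.p_pow_two_pow i (star_realEval hy q) n) hM
    (fun t ht => by
      rw [hX] at ht
      have h := hq t ht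
      rw [eval_map_algebraMap, ← Complex.coe_algebraMap, aeval_algebraMap_apply]
      simpa using h)
  rw [haeval, hN] at this
  exact this

/-- Continuous functional calculus: polynomials converging to a continuous function locally
uniformly on the real line converge when evaluated at a selfadjoint element. -/
theorem exists_limit_realEval {y : A} (hy : star y = y) {f : ℝ → ℝ} (hf : Continuous f) :
    ∃ (q : ℕ → ℝ[X]) (b : A),
      (∀ n : ℕ, ∀ t : ℝ, |t| ≤ n → |(q n).eval t - f t| ≤ 1 / ((n : ℝ) + 1)) ∧
      ∀ i, Tendsto (fun n => pA.p i (realEval y (q n) - b)) atTop (𝓝 0) := by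
  have hq : ∀ n : ℕ, ∃ r : ℝ[X], ∀ t : ℝ, |t| ≤ n → |r.eval t - f t| ≤ 1 / ((n : ℝ) + 1) := by
    intro n
    obtain ⟨r, hr⟩ := exists_polynomial_near_of_continuousOn (-n) n f hf.continuousOn
      (1 / ((n : ℝ) + 1)) (by positivity)
    exact ⟨r, fun t ht => (hr t (abs_le.1 ht)).le⟩
  choose q hq using hq
  have hc : ∀ i, ∀ ε : ℝ, 0 < ε → ∃ n : ℕ, ∀ k, n ≤ k → ∀ l, n ≤ l →
      pA.p i (realEval y (q k) - realEval y (q l)) < ε := by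
    intro i ε hε
    obtain ⟨n₁, h₁⟩ := exists_nat_ge (pA.p i y)
    obtain ⟨n₂, h₂⟩ := exists_nat_one_div_lt (show 0 < ε / 3 by positivity)
    have hle : ∀ k, max n₁ n₂ ≤ k → ∀ t : ℝ, |t| ≤ pA.p i y → |(q k).eval t - f t| ≤ ε / 3 := by
      intro k hk t ht
      have hk1 : (n₁ : ℝ) ≤ k := by exact_mod_cast (le_max_left _ _).trans hk
      have hk2 : (n₂ : ℝ) ≤ k := by exact_mod_cast (le_max_right _ _).trans hk
      refine (hq k t (ht.trans (h₁.trans hk1))).trans (le_trans ?_ h₂.le)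
      gcongr
    refine ⟨max n₁ n₂, fun k hk l hl => ?_⟩
    rw [← map_sub]
    refine (pA.p_realEval_le i hy _ (show 0 ≤ 2 * (ε / 3) by positivity) fun t ht => ?_).trans_lt
      (by linarith)
    have hk' := abs_le.1 (hle k hk t ht)
    have hl' := abs_le.1 (hle l hl t ht)
    rw [eval_sub, abs_le]
    constructor <;> linarith [hk'.1, hk'.2, hl'.1, hl'.2]
  obtain ⟨b, hb⟩ := pA.complete (map (fun n => realEval y (q n)) atTop) inferInstance
    (fun i ε hε => by
      obtain ⟨n, hn⟩ := hc i ε hε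
      refine ⟨(fun n => realEval y (q n)) '' Set.Ici n, image_mem_map (Ici_mem_atTop n), ?_⟩
      rintro _ ⟨k, hk, rfl⟩ _ ⟨l, hl, rfl⟩
      exact hn k hk l hl)
  refine ⟨q, b, hq, fun i => ?_⟩
  rw [Metric.tendsto_nhds]
  intro ε hε
  filter_upwards [mem_map.1 (hb i ε hε)] with n hn
  rw [Real.dist_0_eq_abs, abs_of_nonneg (pA.nonneg _ _)]
  exact hn

/-- Modulo the kernel of `p i`, an element `1 - y` with `y` selfadjoint and `p i y ≤ 1` is of the
form `b⋆ b`. -/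
theorem exists_one_sub_eq_star_mul_self {y : A} (hy : star y = y) (hy1 : pA.p i y ≤ 1) :
    ∃ b : A, pA.p i (1 - y - star b * b) = 0 := by
  obtain ⟨q, b, hq, hb⟩ := pA.exists_limit_realEval hy
    (f := fun t => Real.sqrt (1 - t)) (by fun_prop)
  refine ⟨b, ?_⟩
  have hest : ∀ n : ℕ, 1 ≤ n → pA.p i (1 - y - star b * b) ≤
      5 * (1 / ((n : ℝ) + 1)) + (pA.p i (realEval y (q n) - b) * (pA.p i b +
        (pA.p i (realEval y (q n) - b) + pA.p i b))) := by
    intro n hn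
    set c := realEval y (q n) with hcdef
    have hcs : star c = c := star_realEval hy _
    have h1 : pA.p i (1 - y - c * c) ≤ 5 * (1 / ((n : ℝ) + 1)) := by
      have : 1 - y - c * c = realEval y (1 - X - q n * q n) := by
        simp [hcdef, realEval_X]
      rw [this]
      refine pA.p_realEval_le i hy _ (by positivity) fun t ht => ?_
      have ht1 := ht.trans hy1
      have h := hq n t (ht1.trans (by exact_mod_cast hn))
      have hs := Real.sq_sqrt (show 0 ≤ 1 - t by linarith [(abs_le.1 ht1).2])
      have hs0 := Real.sqrt_nonneg (1 - t)
      have hs2 : Real.sqrt (1 - t) ≤ 2 := by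
        rw [Real.sqrt_le_left (by norm_num)]
        linarith [(abs_le.1 ht1).1]
      simp only [eval_sub, eval_one, eval_X, eval_mul]
      set e := (q n).eval t
      set σ := Real.sqrt (1 - t)
      have hδ1 : 1 / ((n : ℝ) + 1) ≤ 1 := by
        rw [div_le_one (by positivity)]
        linarith [(Nat.cast_nonneg n : (0 : ℝ) ≤ n)]
      have hfac : 1 - t - e * e = -((e - σ) * (e - σ + 2 * σ)) := by rw [← hs]; ring
      rw [hfac, abs_neg, abs_mul, mul_comm 5]
      refine mul_le_mul h ?_ (abs_nonneg _) (by positivity)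
      have h' := abs_le.1 (h.trans hδ1)
      rw [abs_le]
      constructor <;> linarith [h'.1, h'.2]
    have h2 : 1 - y - star b * b = (1 - y - c * c) + (star (c - b) * b + c * (c - b)) := by
      rw [star_sub, hcs]
      noncomm_ring
    rw [h2]
    have h3 : pA.p i c ≤ pA.p i (c - b) + pA.p i b := by simpa using pA.add_le i (c - b) b
    have h4 := pA.mul_le i (star (c - b)) b
    rw [pA.star_eq] at h4
    have h5 := pA.mul_le i c (c - b)
    have h6 := mul_le_mul_of_nonneg_right h3 (pA.nonneg i (c - b))
    have h7 := pA.add_le i (1 - y - c * c) (star (c - b) * b + c * (c - b))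
    have h8 := pA.add_le i (star (c - b) * b) (c * (c - b))
    nlinarith
  have hlim : Tendsto (fun n : ℕ => 5 * (1 / ((n : ℝ) + 1)) +
      (pA.p i (realEval y (q n) - b) * (pA.p i b +
        (pA.p i (realEval y (q n) - b) + pA.p i b)))) atTop (𝓝 0) := by
    have := (tendsto_one_div_add_atTop_nhds_zero_nat (𝕜 := ℝ)).const_mul 5 |>.add
      ((hb i).mul (((hb i).add_const (pA.p i b)).const_add (pA.p i b)))
    simpa using this
  refine le_antisymm (ge_of_tendsto hlim ?_) (pA.nonneg _ _)
  filter_upwards [eventually_ge_atTop 1] with n hn using hest n hn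

end LocallyCStar

/-- Kolmogorov decomposition of a positive semidefinite scalar kernel. -/
theorem exists_kolmogorov_decomposition.{t} {X : Type t} (k : X → X → ℂ)
    (hpos : ∀ f : X →₀ ℂ, 0 ≤ f.sum fun x c => f.sum fun y d => star c * d * k x y) :
    ∃ (E : Type t) (_ : NormedAddCommGroup E) (_ : InnerProductSpace ℂ E) (_ : CompleteSpace E)
      (v : X → E), ∀ x y, ⟪v x, v y⟫_ℂ = k x y := by
  classical
  have hdiag : ∀ x, (k x x).im = 0 := fun x => by
    have h := hpos (Finsupp.single x 1)
    simp only [Finsupp.sum_single_index, star_zero, star_one, zero_mul, mul_zero, one_mul] at h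
    exact (Complex.le_def.1 h).2.symm
  have hzero : ∀ g : X →₀ ℂ, (g.sum fun _ _ => (0 : ℂ)) = 0 := fun g => by simp [Finsupp.sum]
  have hpair : ∀ x y (d : ℂ), (d * k x y + star d * k y x).im = 0 := fun x y d => by
    have h := hpos (Finsupp.single x 1 + Finsupp.single y d)
    rw [Finsupp.sum_add_index' (by simp) (fun a b₁ b₂ => by
      simp only [star_add, add_mul, Finsupp.sum_add])] at h
    simp only [Finsupp.sum_single_index, star_zero, star_one, zero_mul, one_mul,
      hzero] at h
    rw [Finsupp.sum_add_index' (by simp) (by intros; ring),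
      Finsupp.sum_add_index' (by simp) (by intros; ring)] at h
    simp only [Finsupp.sum_single_index, zero_mul, mul_zero, one_mul, mul_one] at h
    have h' := (Complex.le_def.1 h).2.symm
    have hd : (star d * d * k y y).im = 0 := by
      have : star d * d = ((Complex.normSq d : ℝ) : ℂ) := Complex.normSq_eq_conj_mul_self.symm
      rw [this, Complex.im_ofReal_mul, hdiag, mul_zero]
    simp only [Complex.add_im, hdiag, hd, Complex.zero_im] at h' ⊢
    linarith
  have hherm : ∀ x y, star (k y x) = k x y := fun x y => by
    have h1 := hpair x y 1
    have h2 := hpair x y Complex.I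
    simp at h1 h2
    apply Complex.ext <;> simp <;> linarith
  let core : PreInnerProductSpace.Core ℂ (X →₀ ℂ) :=
    { inner := fun f g => f.sum fun x c => g.sum fun y d => star c * d * k x y
      conj_inner_symm := fun f g => by
        rw [Finsupp.sum_comm]
        simp only [map_finsuppSum]
        refine Finsupp.sum_congr fun x _ => Finsupp.sum_congr fun y _ => ?_
        rw [← hherm]
        simp only [map_mul, starRingEnd_apply, star_star]
        ring
      re_inner_nonneg := fun f => (Complex.le_def.1 (hpos f)).1
      add_left := fun f g h => by
        rw [Finsupp.sum_add_index'] <;> simp [← Finsupp.sum_add, add_mul]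
      smul_left := fun f g c => by
        rw [Finsupp.sum_smul_index] <;> simp [Finsupp.mul_sum, ← mul_assoc] }
  let _ : SeminormedAddCommGroup (X →₀ ℂ) :=
    InnerProductSpace.Core.toSeminormedAddCommGroup (𝕜 := ℂ)
  let _ : InnerProductSpace ℂ (X →₀ ℂ) := .ofCore core
  refine ⟨UniformSpace.Completion (X →₀ ℂ), inferInstance, inferInstance, inferInstance,
    fun x => ((Finsupp.single x 1 : X →₀ ℂ) : UniformSpace.Completion (X →₀ ℂ)),
    fun x y => ?_⟩
  rw [UniformSpace.Completion.inner_coe]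
  change (Finsupp.single x (1 : ℂ)).sum (fun x c => (Finsupp.single y (1 : ℂ)).sum
    fun y d => star c * d * k x y) = _
  simp

/-- The universal pair for the Stinespring dilation: a Hilbert space `E` together with a bilinear
map `V : A × H → E` whose Gram kernel is `⟪h, φ (a⋆ b) h'⟫`. -/
theorem exists_bilinear_gram
    {A : Type w} [Ring A] [StarRing A] [Algebra ℂ A] [StarModule ℂ A]
    {H : Type u} [NormedAddCommGroup H] [InnerProductSpace ℂ H] (φ : A →ₗ[ℂ] (H →ₗ[ℂ] H))
    (hpos : ∀ (n : ℕ) (a : Fin n → A) (h : Fin n → H),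
      0 ≤ ∑ i, ∑ j, ⟪h i, φ (star (a i) * a j) (h j)⟫_ℂ) :
    ∃ (E : Type (max u v w)) (_ : NormedAddCommGroup E) (_ : InnerProductSpace ℂ E)
      (_ : CompleteSpace E) (V : A →ₗ[ℂ] H →ₗ[ℂ] E),
      ∀ a b h h', ⟪V a h, V b h'⟫_ℂ = ⟪h, φ (star a * b) h'⟫_ℂ := by
  obtain ⟨E, i₁, i₂, i₃, g, hg⟩ := exists_kolmogorov_decomposition
    (X := ULift.{v} (A × H)) (fun x y => ⟪x.down.2, φ (star x.down.1 * y.down.1) y.down.2⟫_ℂ)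
    (fun f => by
      have h := hpos f.support.card (fun i => (f.support.equivFin.symm i).1.down.1)
        (fun i => f (f.support.equivFin.symm i).1 • (f.support.equivFin.symm i).1.down.2)
      simp only [map_smul, inner_smul_left, inner_smul_right] at h
      convert h using 1
      rw [Finsupp.sum, ← Finset.sum_coe_sort, ← f.support.equivFin.symm.sum_comp]
      refine Finset.sum_congr rfl fun i _ => ?_
      rw [Finsupp.sum, ← Finset.sum_coe_sort, ← f.support.equivFin.symm.sum_comp]
      refine Finset.sum_congr rfl fun j _ => ?_
      rw [starRingEnd_apply, mul_assoc, mul_left_comm])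
  have hzero : ∀ z ∈ Submodule.span ℂ (Set.range g), (∀ x, ⟪g x, z⟫_ℂ = 0) → z = 0 := by
    intro z hz h
    have hle : Submodule.span ℂ (Set.range g) ≤ (ℂ ∙ z)ᗮ := by
      rw [Submodule.span_le]
      rintro _ ⟨x, rfl⟩
      exact Submodule.mem_orthogonal_singleton_iff_inner_left.2 (h x)
    exact inner_self_eq_zero.1 (Submodule.mem_orthogonal_singleton_iff_inner_left.1 (hle hz))
  have hmem : ∀ x, g x ∈ Submodule.span ℂ (Set.range g) := fun x =>
    Submodule.subset_span ⟨x, rfl⟩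
  refine ⟨E, i₁, i₂, i₃, LinearMap.mk₂ ℂ (fun a h => g ⟨(a, h)⟩) ?_ ?_ ?_ ?_,
    fun a b h h' => hg _ _⟩
  · intro a a' h
    rw [← sub_eq_zero]
    refine hzero _ (sub_mem (hmem _) (add_mem (hmem _) (hmem _))) fun x => ?_
    simp [hg, mul_add]
  · intro c a h
    rw [← sub_eq_zero]
    refine hzero _ (sub_mem (hmem _) (Submodule.smul_mem _ _ (hmem _))) fun x => ?_
    simp [hg]
  · intro a h h'
    rw [← sub_eq_zero]
    refine hzero _ (sub_mem (hmem _) (add_mem (hmem _) (hmem _))) fun x => ?_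
    simp [hg]
  · intro c a h
    rw [← sub_eq_zero]
    refine hzero _ (sub_mem (hmem _) (Submodule.smul_mem _ _ (hmem _))) fun x => ?_
    simp [hg]

section Stinespring

variable {Λ : Type v} [PartialOrder Λ]
  {A : Type w} [Ring A] [Algebra ℂ A]
  {H : Type u} [NormedAddCommGroup H] [InnerProductSpace ℂ H]
  {E : Type x} [NormedAddCommGroup E] [InnerProductSpace ℂ E]
  (hH : LocallyHilbert Λ H) (V : A →ₗ[ℂ] H →ₗ[ℂ] E)

/-- The generating vectors of the local dilation space at `lam`. -/
def dilationGen (lam : Λ) : Set E := {x | ∃ b : A, ∃ h ∈ hH.E lam, V b h = x}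

/-- The local dilation space at `lam`. -/
def dilationSpace (lam : Λ) : Submodule ℂ E :=
  (Submodule.span ℂ (dilationGen hH V lam)).topologicalClosure

theorem isClosed_dilationSpace (lam : Λ) : IsClosed (dilationSpace hH V lam : Set E) :=
  Submodule.isClosed_topologicalClosure _

theorem mem_dilationSpace {lam : Λ} (b : A) {h : H} (hh : h ∈ hH.E lam) :
    V b h ∈ dilationSpace hH V lam :=
  Submodule.le_topologicalClosure _ (Submodule.subset_span ⟨b, h, hh, rfl⟩)

theorem dilationSpace_le {lam : Λ} {p : Submodule ℂ E} (hp : IsClosed (p : Set E))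
    (h : ∀ b, ∀ h ∈ hH.E lam, V b h ∈ p) : dilationSpace hH V lam ≤ p := by
  refine Submodule.topologicalClosure_minimal _ (Submodule.span_le.2 ?_) hp
  rintro _ ⟨b, g, hg, rfl⟩
  exact h b g hg

theorem dilationSpace_mono : Monotone (dilationSpace hH V) := fun _ _ hle =>
  dilationSpace_le hH V (isClosed_dilationSpace hH V _) fun b _ hh =>
    mem_dilationSpace hH V b (hH.mono hle hh)

theorem eqOn_dilationSpace {F : Type*} [NormedAddCommGroup F] [NormedSpace ℂ F] {lam : Λ}
    {S T : E →L[ℂ] F} (h : ∀ b, ∀ h ∈ hH.E lam, S (V b h) = T (V b h)) {k : E}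
    (hk : k ∈ dilationSpace hH V lam) : S k = T k := by
  have : dilationSpace hH V lam ≤ (S - T).ker :=
    dilationSpace_le hH V (ContinuousLinearMap.isClosed_ker _) fun b g hg => by
      simp [h b g hg]
  simpa [sub_eq_zero] using this hk

variable [StarRing A] {φ : A →ₗ[ℂ] (H →ₗ[ℂ] H)}

theorem exists_bound_of_gram (hφlb : ∀ a : A, IsLocallyBounded hH hH (φ a))
    (hV : ∀ a b h h', ⟪V a h, V b h'⟫_ℂ = ⟪h, φ (star a * b) h'⟫_ℂ) (lam : Λ) :
    ∃ C : ℝ, ∀ h ∈ hH.E lam, ‖V 1 h‖ ≤ C * ‖h‖ := by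
  obtain ⟨C, hC⟩ := (hφlb 1).bound lam
  refine ⟨√|C|, fun h hh => ?_⟩
  refine le_of_sq_le_sq ?_ (by positivity)
  rw [mul_pow, Real.sq_sqrt (abs_nonneg C)]
  calc ‖V 1 h‖ ^ 2 = ‖⟪h, φ 1 h⟫_ℂ‖ := by
        have h1 := hV 1 1 h h
        rw [star_one, one_mul] at h1
        rw [← h1, inner_self_eq_norm_sq_to_K]
        simp
    _ ≤ ‖h‖ * ‖φ 1 h‖ := norm_inner_le_norm _ _
    _ ≤ ‖h‖ * (|C| * ‖h‖) := by
        gcongr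
        exact (hC h hh).trans (by gcongr; exact le_abs_self C)
    _ = |C| * ‖h‖ ^ 2 := by ring

variable [CompleteSpace E]

theorem exists_adjoint_vector (hφlb : ∀ a : A, IsLocallyBounded hH hH (φ a))
    (hV : ∀ a b h h', ⟪V a h, V b h'⟫_ℂ = ⟪h, φ (star a * b) h'⟫_ℂ) {lam : Λ} {k : E}
    (hk : k ∈ dilationSpace hH V lam) :
    ∃ u ∈ hH.E lam, ∀ h : H, ⟪V 1 h, k⟫_ℂ = ⟪h, u⟫_ℂ := by
  obtain ⟨C, hC⟩ := exists_bound_of_gram hH V hφlb hV lam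
  have : CompleteSpace (hH.E lam) := (hH.isComplete lam).completeSpace_coe
  let W : hH.E lam →L[ℂ] E :=
    (V 1 ∘ₗ (hH.E lam).subtype).mkContinuous C fun h => hC h h.2
  have horth : ∀ g ∈ (hH.E lam)ᗮ, ⟪V 1 g, k⟫_ℂ = 0 := by
    intro g hg
    have hle : dilationSpace hH V lam ≤ (ℂ ∙ V 1 g)ᗮ := by
      refine dilationSpace_le hH V (Submodule.isClosed_orthogonal _) fun b h hh => ?_
      rw [Submodule.mem_orthogonal_singleton_iff_inner_right, hV]
      exact Submodule.inner_left_of_mem_orthogonal ((hφlb _).maps_mem lam h hh) hg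
    exact Submodule.mem_orthogonal_singleton_iff_inner_right.1 (hle hk)
  refine ⟨W.adjoint k, (W.adjoint k).2, fun h => ?_⟩
  set g : hH.E lam := (hH.E lam).orthogonalProjectionOnto h with hg
  have hmem : h - g ∈ (hH.E lam)ᗮ := Submodule.sub_starProjection_mem_orthogonal h
  have h1 : ⟪V 1 g, k⟫_ℂ = ⟪(g : H), W.adjoint k⟫_ℂ :=
    (ContinuousLinearMap.adjoint_inner_right W g k).symm
  have h2 := horth _ hmem
  rw [map_sub, inner_sub_left, sub_eq_zero] at h2
  have h3 := Submodule.inner_left_of_mem_orthogonal (W.adjoint k).2 hmem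
  rw [inner_sub_left, sub_eq_zero] at h3
  rw [h2, h1, h3]

variable [StarModule ℂ A]

/-- The Hilbert space operators inducing the dilation representation on the local dilation
spaces. The bound uses that a positive functional vanishing on the kernel of `p lam` is
bounded. -/
theorem exists_dilation_operator (pA : LocallyCStar Λ A)
    (hφ : ∀ (lam : Λ) (a : A), pA.p lam a = 0 → ∀ h ∈ hH.E lam, φ a h = 0)
    (hV : ∀ a b h h', ⟪V a h, V b h'⟫_ℂ = ⟪h, φ (star a * b) h'⟫_ℂ) (lam : Λ) (a : A) :
    ∃ L : E →L[ℂ] E, ∀ b, ∀ h ∈ hH.E lam, L (V b h) = V (a * b) h := by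
  let T : A → (A × hH.E lam →₀ ℂ) →ₗ[ℂ] E := fun c =>
    Finsupp.linearCombination ℂ fun x => V (c * x.1) x.2
  have hTs : ∀ c x r, T c (Finsupp.single x r) = r • V (c * x.1) x.2 := fun c x r => by
    simp [T]
  have hinner : ∀ c d f g, ⟪T c f, T d g⟫_ℂ = ⟪T 1 f, T (star c * d) g⟫_ℂ := by
    intro c d f g
    induction f using Finsupp.induction_linear with
    | zero => simp
    | add f f' hf hf' => simp only [map_add, inner_add_left, hf, hf']
    | single x r =>
      induction g using Finsupp.induction_linear with
      | zero => simp
      | add g g' hg hg' => simp only [map_add, inner_add_right, hg, hg']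
      | single y s =>
        simp only [hTs, inner_smul_left, inner_smul_right, hV, star_mul, one_mul, mul_assoc]
  have hsub : ∀ c d f, T (c - d) f = T c f - T d f := by
    intro c d f
    induction f using Finsupp.induction_linear with
    | zero => simp
    | add f f' hf hf' => simp only [map_add, hf, hf']; abel
    | single x r => simp [hTs, sub_mul, smul_sub]
  have hsmul : ∀ (s : ℂ) c f, T (s • c) f = s • T c f := by
    intro s c f
    induction f using Finsupp.induction_linear with
    | zero => simp
    | add f f' hf hf' => simp only [map_add, hf, hf', smul_add]
    | single x r => simp [hTs, smul_comm s r]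
  have hker : ∀ c, pA.p lam c = 0 → ∀ f, T c f = 0 := by
    intro c hc f
    induction f using Finsupp.induction_linear with
    | zero => simp
    | add f f' hf hf' => simp [map_add, hf, hf']
    | single x r =>
      have h0 : pA.p lam (star (c * x.1) * (c * x.1)) = 0 := by
        have h := pA.mul_le lam c x.1
        rw [hc, zero_mul] at h
        rw [pA.cstar, le_antisymm h (pA.nonneg _ _), zero_pow two_ne_zero]
      have : V (c * x.1) x.2 = 0 := by
        rw [← inner_self_eq_zero (𝕜 := ℂ), hV, hφ lam _ h0 _ x.2.2, inner_zero_right]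
      rw [hTs, this, smul_zero]
  set C : ℝ := pA.p lam a + 1 with hC
  have hp0 := pA.nonneg lam a
  have hC0 : 0 < C := by positivity
  have hbound : ∀ f, ‖T a f‖ ≤ C * ‖T 1 f‖ := by
    intro f
    set y : A := (((C ^ 2)⁻¹ : ℝ) : ℂ) • (star a * a) with hy
    have hys : star y = y := by
      simp [hy, star_smul]
    have hy1 : pA.p lam y ≤ 1 := by
      rw [hy, pA.smul_eq, pA.cstar, Complex.norm_real, Real.norm_of_nonneg (by positivity),
        inv_mul_le_one₀ (by positivity)]
      exact pow_le_pow_left₀ hp0 (by linarith) 2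
    obtain ⟨b, hb⟩ := pA.exists_one_sub_eq_star_mul_self lam hys hy1
    have h := hker _ hb f
    rw [hsub, hsub, hy, hsmul] at h
    have hre : ∀ z : E, (⟪z, z⟫_ℂ).re = ‖z‖ ^ 2 := fun z => inner_self_eq_norm_sq (𝕜 := ℂ) z
    have h2 := congrArg (fun z => (⟪T 1 f, z⟫_ℂ).re) h
    simp only [inner_sub_right, inner_smul_right, ← hinner, inner_zero_right, Complex.sub_re,
      Complex.re_ofReal_mul, hre, Complex.zero_re] at h2
    have h3 : (C ^ 2)⁻¹ * ‖T a f‖ ^ 2 ≤ ‖T 1 f‖ ^ 2 := by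
      linarith [sq_nonneg ‖T b f‖]
    rw [inv_mul_le_iff₀ (by positivity), ← mul_pow] at h3
    exact le_of_sq_le_sq h3 (by positivity)
  have hmem : ∀ f, T 1 f ∈ dilationSpace hH V lam := by
    intro f
    induction f using Finsupp.induction_linear with
    | zero => simp
    | add f f' hf hf' => rw [map_add]; exact add_mem hf hf'
    | single x r =>
      rw [hTs]
      exact Submodule.smul_mem _ _ (mem_dilationSpace hH V _ x.2.2)
  let e := (T 1).codRestrict (dilationSpace hH V lam) hmem
  have hdense : DenseRange e := by
    refine Subtype.dense_iff.2 ?_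
    have hle : dilationSpace hH V lam ≤ (T 1).range.topologicalClosure := by
      refine dilationSpace_le hH V (Submodule.isClosed_topologicalClosure _) fun b h hh => ?_
      refine Submodule.le_topologicalClosure _ ⟨Finsupp.single (b, ⟨h, hh⟩) 1, ?_⟩
      simp [hTs]
    refine fun k hk => closure_mono ?_ (hle hk)
    rintro _ ⟨f, rfl⟩
    exact ⟨e f, ⟨f, rfl⟩, rfl⟩
  have : CompleteSpace (dilationSpace hH V lam) :=
    (isClosed_dilationSpace hH V lam).completeSpace_coe
  refine ⟨(T a).extendOfNorm e ∘L (dilationSpace hH V lam).orthogonalProjectionOnto,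
    fun b h hh => ?_⟩
  have hbe : V b h = e (Finsupp.single (b, ⟨h, hh⟩) 1) := by simp [e, hTs]
  rw [ContinuousLinearMap.comp_apply, hbe, Submodule.orthogonalProjectionOnto_mem_subspace_eq_self,
    LinearMap.extendOfNorm_eq hdense ⟨C, hbound⟩, hTs, one_smul]

/-- The Stinespring dilation constructed inside a Hilbert space containing a Gram representation
of the kernel `⟪h, φ (a⋆ b) h'⟫`. -/
theorem exists_coherent_dilation [Nonempty Λ] [IsDirected Λ (· ≤ ·)] (pA : LocallyCStar Λ A)
    (hφlb : ∀ a : A, IsLocallyBounded hH hH (φ a))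
    (hφ : ∀ (lam : Λ) (a : A), pA.p lam a = 0 → ∀ h ∈ hH.E lam, φ a h = 0)
    (hV : ∀ a b h h', ⟪V a h, V b h'⟫_ℂ = ⟪h, φ (star a * b) h'⟫_ℂ) :
    ∃ (Kb : LocHilbertBundle.{x, v} Λ)
       (π : A →ₗ[ℂ] (Kb.carrier →ₗ[ℂ] Kb.carrier)) (W : H →ₗ[ℂ] Kb.carrier),
      (∀ a : A, IsLocallyBounded Kb.str Kb.str (π a)) ∧
      (∀ a b : A, π (a * b) = (π a) ∘ₗ (π b)) ∧
      (∀ a : A, IsLAdjoint (π a) (π (star a))) ∧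
      (∀ (lam : Λ) (a : A), pA.p lam a = 0 → ∀ k ∈ Kb.str.E lam, π a k = 0) ∧
      IsLocallyBounded hH Kb.str W ∧
      (∀ (a : A) (h h' : H), ⟪h, φ a h'⟫_ℂ = ⟪W h, π a (W h')⟫_ℂ) := by
  choose L hL using exists_dilation_operator hH V pA hφ hV
  set S : Λ → Submodule ℂ E := dilationSpace hH V with hS
  have hmono : Monotone S := dilationSpace_mono hH V
  set K : Submodule ℂ E := ⨆ lam, S lam with hK
  have hmemK : ∀ {k : E}, k ∈ K ↔ ∃ lam, k ∈ S lam := fun {k} =>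
    Submodule.mem_iSup_of_directed _ hmono.directed_le
  have hSK : ∀ lam, S lam ≤ K := fun lam => le_iSup S lam
  have hLS : ∀ lam a, ∀ k ∈ S lam, L lam a k ∈ S lam := by
    intro lam a k hk
    have hle : S lam ≤ (S lam).comap (L lam a).toLinearMap :=
      dilationSpace_le hH V
        ((isClosed_dilationSpace hH V lam).preimage (L lam a).continuous) fun b h hh => by
          rw [Submodule.mem_comap, ContinuousLinearMap.coe_coe, hL lam a b h hh]
          exact mem_dilationSpace hH V _ hh
    exact hle hk
  have hLle : ∀ {lam mu a k}, lam ≤ mu → k ∈ S lam → L lam a k = L mu a k := fun hle hk =>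
    eqOn_dilationSpace hH V (fun b h hh => by rw [hL _ _ b h hh, hL _ _ b h (hH.mono hle hh)]) hk
  let idx : K → Λ := fun k => (hmemK.1 k.2).choose
  have hidx : ∀ k : K, (k : E) ∈ S (idx k) := fun k => (hmemK.1 k.2).choose_spec
  have hLidx : ∀ {lam} (a) (k : K), (k : E) ∈ S lam → L (idx k) a k = L lam a k := by
    intro lam a k hk
    obtain ⟨mu, h1, h2⟩ := exists_ge_ge (idx k) lam
    rw [hLle h1 (hidx k), hLle h2 hk]
  let str : LocallyHilbert Λ K :=
    { E := fun lam => (S lam).comap K.subtype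
      mono := fun _ _ hle => Submodule.comap_mono (hmono hle)
      isComplete := fun lam => by
        rw [← isUniformEmbedding_subtype_val.isUniformInducing.isComplete_iff]
        have : Subtype.val '' (((S lam).comap K.subtype : Submodule ℂ K) : Set K)
            = (S lam : Set E) := by
          ext k
          simp only [Set.mem_image, SetLike.mem_coe, Submodule.mem_comap]
          exact ⟨fun ⟨k', h, e⟩ => e ▸ h, fun h => ⟨⟨k, hSK lam h⟩, h, rfl⟩⟩
        rw [this]
        exact (isClosed_dilationSpace hH V lam).isComplete
      exhaustive := fun k => hmemK.1 k.2 }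
  have hcommon : ∀ k k' : K, ∃ lam, (k : E) ∈ S lam ∧ (k' : E) ∈ S lam := fun k k' => by
    obtain ⟨mu, h1, h2⟩ := exists_ge_ge (idx k) (idx k')
    exact ⟨mu, hmono h1 (hidx k), hmono h2 (hidx k')⟩
  let π : A →ₗ[ℂ] (K →ₗ[ℂ] K) := LinearMap.mk₂ ℂ
    (fun a k => ⟨L (idx k) a k, hSK _ (hLS _ a k (hidx k))⟩)
    (fun a a' k => Subtype.ext <| eqOn_dilationSpace hH V
      (T := L (idx k) a + L (idx k) a') (fun b h hh => by simp [hL _ _ b h hh, add_mul])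
      (hidx k))
    (fun c a k => Subtype.ext <| eqOn_dilationSpace hH V
      (T := c • L (idx k) a) (fun b h hh => by simp [hL _ _ b h hh]) (hidx k))
    (fun a k k' => Subtype.ext <| by
      obtain ⟨lam, h, h'⟩ := hcommon k k'
      change L _ a _ = L _ a _ + L _ a _
      rw [hLidx a k h, hLidx a k' h', hLidx a (k + k') (add_mem h h'), ← map_add]
      rfl)
    (fun c a k => Subtype.ext <| by
      change L _ a _ = c • L _ a _
      rw [hLidx a (c • k) (Submodule.smul_mem _ c (hidx k)), ← map_smul]
      rfl)
  have hπ : ∀ {lam} (a) (k : K), (k : E) ∈ S lam → (π a k : E) = L lam a k := hLidx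
  have hπS : ∀ {lam} (a) (k : K), (k : E) ∈ S lam → (π a k : E) ∈ S lam := fun a k hk => by
    rw [hπ a k hk]
    exact hLS _ a k hk
  have hπadj : ∀ a, IsLAdjoint (π a) (π (star a)) := by
    intro a k k'
    obtain ⟨lam, h, h'⟩ := hcommon k k'
    change ⟪(π a k : E), (k' : E)⟫_ℂ = ⟪(k : E), (π (star a) k' : E)⟫_ℂ
    rw [hπ a k h, hπ (star a) k' h', ← ContinuousLinearMap.adjoint_inner_right]
    refine eqOn_dilationSpace hH V (S := innerSL ℂ (k : E) ∘L (L lam a).adjoint)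
      (T := innerSL ℂ (k : E) ∘L L lam (star a)) (fun b g hg => ?_) h'
    simp only [ContinuousLinearMap.comp_apply, innerSL_apply_apply]
    rw [← inner_conj_symm, ← inner_conj_symm (k : E)]
    congr 1
    refine eqOn_dilationSpace hH V (S := innerSL ℂ ((L lam a).adjoint (V b g)))
      (T := innerSL ℂ (L lam (star a) (V b g))) (fun c f hf => ?_) h
    simp only [innerSL_apply_apply]
    rw [ContinuousLinearMap.adjoint_inner_left, hL _ _ c f hf, hL _ _ b g hg, hV, hV, star_mul,
      star_star, mul_assoc]
  have hVK : ∀ h, V 1 h ∈ K := fun h => by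
    obtain ⟨lam, hlam⟩ := hH.exhaustive h
    exact hSK lam (mem_dilationSpace hH V 1 hlam)
  refine ⟨⟨K, str⟩, π, (V 1).codRestrict K hVK, fun a => ⟨?_, ?_, ?_⟩, fun a b => ?_, hπadj,
    fun lam a ha k hk => ?_, ⟨?_, ?_, ?_⟩, fun a h h' => ?_⟩
  · exact fun lam k hk => hπS a k hk
  · refine fun lam => ⟨‖L lam a‖, fun k hk => ?_⟩
    change ‖(π a k : E)‖ ≤ _
    rw [hπ a k hk]
    exact (L lam a).le_opNorm k
  · exact fun lam k hk => ⟨π (star a) k, hπS (star a) k hk, fun k' => hπadj a k' k⟩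
  · refine LinearMap.ext fun k => Subtype.ext ?_
    change (π (a * b) k : E) = π a (π b k)
    rw [hπ _ k (hidx k), hπ a _ (hπS b k (hidx k)), hπ b k (hidx k)]
    exact eqOn_dilationSpace hH V (T := L (idx k) a ∘L L (idx k) b)
      (fun c h hh => by simp [hL _ _ _ h hh, mul_assoc]) (hidx k)
  · refine Subtype.ext ?_
    rw [hπ a k hk]
    refine eqOn_dilationSpace hH V (T := 0) (fun b h hh => ?_) hk
    have h0 : pA.p lam (star (a * b) * (a * b)) = 0 := by
      have h := pA.mul_le lam a b
      rw [ha, zero_mul] at h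
      rw [pA.cstar, le_antisymm h (pA.nonneg _ _), zero_pow two_ne_zero]
    rw [hL _ _ _ h hh, zero_apply, ← inner_self_eq_zero (𝕜 := ℂ), hV,
      hφ lam _ h0 h hh, inner_zero_right]
  · exact fun lam h hh => mem_dilationSpace hH V 1 hh
  · exact exists_bound_of_gram hH V hφlb hV
  · exact fun lam k hk => exists_adjoint_vector hH V hφlb hV hk
  · obtain ⟨lam, hlam⟩ := hH.exhaustive h'
    change _ = ⟪V 1 h, (π a ⟨V 1 h', hVK h'⟩ : E)⟫_ℂ
    rw [hπ a _ (mem_dilationSpace hH V 1 hlam), hL _ _ _ _ hlam, hV, star_one, one_mul, mul_one]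

end Stinespring

/-- Coherent Stinespring theorem: for a coherent linear map
`φ : A → B_loc(H)` on a unital locally C*-algebra `A`, with seminorms and subspaces
indexed by the same directed poset `Λ`, `φ` is positive semidefinite (completely
positive) iff `φ(a) = W* ∘ π(a) ∘ W` for a coherent `*`-representation `π` of `A` on a
locally Hilbert space `K` over `Λ` and some `W ∈ B_loc(H,K)`. -/
theorem coherent_stinespring
    {Λ : Type v} [PartialOrder Λ] [Nonempty Λ] [IsDirected Λ (· ≤ ·)]
    {A : Type w} [Ring A] [StarRing A] [Algebra ℂ A] [StarModule ℂ A]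
    (pA : LocallyCStar Λ A)
    {H : Type u} [NormedAddCommGroup H] [InnerProductSpace ℂ H]
    (hH : LocallyHilbert Λ H)
    (φ : A →ₗ[ℂ] (H →ₗ[ℂ] H))
    (hφlb : ∀ a : A, IsLocallyBounded hH hH (φ a))
    (hφcoh : ∀ (lam : Λ) (a : A), pA.p lam a = 0 → ∀ h ∈ hH.E lam, φ a h = 0) :
    (∀ (n : ℕ) (a : Fin n → A) (h : Fin n → H),
        0 ≤ ∑ i, ∑ j, ⟪h i, φ (star (a i) * a j) (h j)⟫_ℂ) ↔
    (∃ (Kb : LocHilbertBundle.{max u v w, v} Λ)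
       (π : A →ₗ[ℂ] (Kb.carrier →ₗ[ℂ] Kb.carrier)) (W : H →ₗ[ℂ] Kb.carrier),
      (∀ a : A, IsLocallyBounded Kb.str Kb.str (π a)) ∧
      (∀ a b : A, π (a * b) = (π a) ∘ₗ (π b)) ∧
      (∀ a : A, IsLAdjoint (π a) (π (star a))) ∧
      (∀ (lam : Λ) (a : A), pA.p lam a = 0 → ∀ k ∈ Kb.str.E lam, π a k = 0) ∧
      IsLocallyBounded hH Kb.str W ∧
      (∀ (a : A) (h h' : H), ⟪h, φ a h'⟫_ℂ = ⟪W h, π a (W h')⟫_ℂ)) := by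
  constructor
  · intro hpos
    obtain ⟨E, _, _, _, V, hV⟩ := exists_bilinear_gram.{u, v, w} φ hpos
    exact exists_coherent_dilation hH V pA hφlb hφcoh hV
  · rintro ⟨Kb, π, W, -, hmul, hadj, -, -, hφπ⟩ n a h
    have key : ∑ i, ∑ j, ⟪h i, φ (star (a i) * a j) (h j)⟫_ℂ =
        ⟪∑ i, π (a i) (W (h i)), ∑ j, π (a j) (W (h j))⟫_ℂ := by
      rw [sum_inner]
      refine Finset.sum_congr rfl fun i _ => ?_
      rw [inner_sum]
      refine Finset.sum_congr rfl fun j _ => ?_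
      rw [hφπ, hmul, LinearMap.comp_apply]
      exact (hadj (a i) (W (h i)) (π (a j) (W (h j)))).symm
    rw [key, inner_self_eq_norm_sq_to_K]
    exact (Complex.zero_le_real.2 (sq_nonneg ‖∑ i, π (a i) (W (h i))‖)).trans_eq
      (Complex.ofReal_pow _ 2)
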